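/- (Corollary 2, effects of κ) Under the hypotheses of Theorem 2 with 0 < β ≤ 1 fixed and κ ≥ 1/β — λ a σ-finite measure on Ω, μ = λ.withDensity p and ν = λ.withDensity q probability measures, S ⊆ Ω measurable, b ∈ (0,1], κ ≥ max(1, 1/β), Z = 1 − b/κ + β·b, μ(S) = b/κ, ν(S) = β·b/Z, q = p/Z λ-a.e. off S, and S_val = ∫_S max(q/ν(S) − p/μ(S), 0) dλ — one has d_{H−W1}(μ, ν) ≤ β·b; moreover, if κ = 1/β then S_val·β·b ≤ d_{H−W1}(μ, ν) ≤ β·b. -/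

import Mathlib

open MeasureTheory

/-- The `H`–`W1` distance between two measures: the supremum of
`∫ h dμ − ∫ h dν` over measurable functions `h` with values in `[0,1]`. -/
noncomputable def dHW1 {Ω : Type*} [MeasurableSpace Ω] (μ ν : Measure Ω) : ℝ :=
  sSup {r : ℝ | ∃ h : Ω → ℝ, Measurable h ∧ (∀ ω, 0 ≤ h ω) ∧ (∀ ω, h ω ≤ 1) ∧
    r = ∫ ω, h ω ∂μ - ∫ ω, h ω ∂ν}

section

variable {Ω : Type*} [MeasurableSpace Ω] {lam : Measure Ω} {p q : Ω → ℝ}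

lemma integral_withDensity_ofReal (hp : Measurable p) (hp0 : ∀ ω, 0 ≤ p ω) (g : Ω → ℝ) :
    ∫ ω, g ω ∂(lam.withDensity fun ω => ENNReal.ofReal (p ω)) = ∫ ω, p ω * g ω ∂lam := by
  rw [integral_withDensity_eq_integral_toReal_smul hp.ennreal_ofReal (by simp)]
  simp only [ENNReal.toReal_ofReal (hp0 _), smul_eq_mul]

lemma integrable_of_isFiniteMeasure_withDensity (hp : Measurable p) (hp0 : ∀ ω, 0 ≤ p ω)
    [IsFiniteMeasure (lam.withDensity fun ω => ENNReal.ofReal (p ω))] : Integrable p lam := by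
  have h := (integrable_withDensity_iff_integrable_smul' (μ := lam) hp.ennreal_ofReal (by simp)
    (g := fun _ => (1 : ℝ))).1 (integrable_const 1)
  simpa [ENNReal.toReal_ofReal (hp0 _)] using h

/-- For probability measures, a difference of integrals of `h` is an integral of
`1 - h` against the opposite difference of densities. -/
lemma integral_sub_integral_eq_integral_one_sub (hp : Measurable p) (hq : Measurable q)
    (hp0 : ∀ ω, 0 ≤ p ω) (hq0 : ∀ ω, 0 ≤ q ω)
    [IsProbabilityMeasure (lam.withDensity fun ω => ENNReal.ofReal (p ω))]
    [IsProbabilityMeasure (lam.withDensity fun ω => ENNReal.ofReal (q ω))]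
    {h : Ω → ℝ} (hm : Measurable h) (h0 : ∀ ω, 0 ≤ h ω) (h1 : ∀ ω, h ω ≤ 1) :
    Integrable (fun ω => (q ω - p ω) * (1 - h ω)) lam ∧
      ∫ ω, h ω ∂(lam.withDensity fun ω => ENNReal.ofReal (p ω)) -
        ∫ ω, h ω ∂(lam.withDensity fun ω => ENNReal.ofReal (q ω)) =
      ∫ ω, (q ω - p ω) * (1 - h ω) ∂lam := by
  have ip : Integrable p lam := integrable_of_isFiniteMeasure_withDensity hp hp0
  have iq : Integrable q lam := integrable_of_isFiniteMeasure_withDensity hq hq0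
  have mass {f : Ω → ℝ} (hf : Measurable f) (hf0 : ∀ ω, 0 ≤ f ω)
      [IsProbabilityMeasure (lam.withDensity fun ω => ENNReal.ofReal (f ω))] :
      ∫ ω, f ω ∂lam = 1 := by
    simpa using (integral_withDensity_ofReal (lam := lam) hf hf0 fun _ => 1).symm
  have bound : ∀ᵐ ω ∂lam, ‖h ω‖ ≤ 1 := .of_forall fun ω => by
    rw [Real.norm_of_nonneg (h0 ω)]; exact h1 ω
  have iph : Integrable (fun ω => p ω * h ω) lam := ip.mul_bdd hm.aestronglyMeasurable bound
  have iqh : Integrable (fun ω => q ω * h ω) lam := iq.mul_bdd hm.aestronglyMeasurable bound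
  have e : (fun ω => (q ω - p ω) * (1 - h ω)) =
      fun ω => (q ω - p ω) - (q ω * h ω - p ω * h ω) := by
    funext ω; ring
  have iqp : Integrable (fun ω => q ω - p ω) lam := iq.sub ip
  have iqph : Integrable (fun ω => q ω * h ω - p ω * h ω) lam := iqh.sub iph
  refine ⟨e ▸ iqp.sub iqph, ?_⟩
  rw [e, integral_sub iqp iqph, integral_sub iq ip, integral_sub iqh iph,
    mass hp hp0, mass hq hq0, integral_withDensity_ofReal hp hp0,
    integral_withDensity_ofReal hq hq0]
  ring

/-- If `q ≤ p` off `S`, integrals of `[0,1]`-valued functions against the density `p`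
exceed those against `q` by at most the `q`-mass of `S`. -/
lemma integral_sub_integral_le_measure (hp : Measurable p) (hq : Measurable q)
    (hp0 : ∀ ω, 0 ≤ p ω) (hq0 : ∀ ω, 0 ≤ q ω)
    [IsProbabilityMeasure (lam.withDensity fun ω => ENNReal.ofReal (p ω))]
    [IsProbabilityMeasure (lam.withDensity fun ω => ENNReal.ofReal (q ω))]
    {S : Set Ω} (hS : MeasurableSet S) (hoff : ∀ᵐ ω ∂lam, ω ∉ S → q ω ≤ p ω)
    {h : Ω → ℝ} (hm : Measurable h) (h0 : ∀ ω, 0 ≤ h ω) (h1 : ∀ ω, h ω ≤ 1) :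
    ∫ ω, h ω ∂(lam.withDensity fun ω => ENNReal.ofReal (p ω)) -
        ∫ ω, h ω ∂(lam.withDensity fun ω => ENNReal.ofReal (q ω)) ≤
      (lam.withDensity (fun ω => ENNReal.ofReal (q ω)) S).toReal := by
  have iq : Integrable q lam := integrable_of_isFiniteMeasure_withDensity hq hq0
  obtain ⟨hi, he⟩ := integral_sub_integral_eq_integral_one_sub (lam := lam) hp hq hp0 hq0 hm h0 h1
  rw [he, withDensity_apply _ hS,
    ← integral_eq_lintegral_of_nonneg_ae (.of_forall hq0) hq.aestronglyMeasurable,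
    ← integral_indicator hS]
  refine integral_mono_ae hi (iq.indicator hS) ?_
  filter_upwards [hoff] with ω hω
  by_cases hs : ω ∈ S
  · rw [Set.indicator_of_mem hs]
    nlinarith [mul_nonneg (hp0 ω) (sub_nonneg.2 (h1 ω)), mul_nonneg (hq0 ω) (h0 ω)]
  · rw [Set.indicator_of_notMem hs]
    exact mul_nonpos_of_nonpos_of_nonneg (sub_nonpos.2 (hω hs)) (sub_nonneg.2 (h1 ω))

end

/-- (Corollary 2, effects of κ.) Under the hypotheses of Theorem 2 with `0 < β ≤ 1`
fixed and `κ ≥ max(1, 1/β)`, one has `d_{H−W1}(μ, ν) ≤ β·b`; moreover, if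
`κ = 1/β`, then `S_val·β·b ≤ d_{H−W1}(μ, ν) ≤ β·b`. -/
theorem dHW1_kappa_effect {Ω : Type*} [MeasurableSpace Ω]
    (lam : Measure Ω) [SigmaFinite lam]
    (p q : Ω → ℝ) (hp : Measurable p) (hq : Measurable q)
    (hp0 : ∀ ω, 0 ≤ p ω) (hq0 : ∀ ω, 0 ≤ q ω)
    (μ ν : Measure Ω) [IsProbabilityMeasure μ] [IsProbabilityMeasure ν]
    (hμ : μ = lam.withDensity fun ω => ENNReal.ofReal (p ω))
    (hν : ν = lam.withDensity fun ω => ENNReal.ofReal (q ω))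
    (S : Set Ω) (hS : MeasurableSet S)
    (b κ β Z : ℝ) (hb0 : 0 < b) (hb1 : b ≤ 1)
    (hβ0 : 0 < β) (hβ1 : β ≤ 1) (hκ : max 1 (1 / β) ≤ κ)
    (hZ : Z = 1 - b / κ + β * b)
    (hμS : (μ S).toReal = b / κ) (hνS : (ν S).toReal = β * b / Z)
    (hoff : ∀ᵐ ω ∂lam, ω ∉ S → q ω = p ω / Z)
    (Sval : ℝ)
    (hSval : Sval = ∫ ω in S, max (q ω / (ν S).toReal - p ω / (μ S).toReal) 0 ∂lam) :
    dHW1 μ ν ≤ β * b ∧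
      (κ = 1 / β → Sval * β * b ≤ dHW1 μ ν ∧ dHW1 μ ν ≤ β * b) := by
  subst hμ hν
  obtain ⟨hκ1, hκβ⟩ := max_le_iff.1 hκ
  have hκ0 : 0 < κ := by linarith
  have hbκ : b / κ ≤ β * b := by
    rw [div_le_iff₀ hκ0]
    rw [div_le_iff₀ hβ0] at hκβ
    nlinarith
  have hZ1 : 1 ≤ Z := by linarith
  have hle : ∀ᵐ ω ∂lam, ω ∉ S → q ω ≤ p ω := by
    filter_upwards [hoff] with ω hω hs
    rw [hω hs]
    exact div_le_self (hp0 ω) hZ1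
  have hub : ∀ r ∈ {r : ℝ | ∃ h : Ω → ℝ, Measurable h ∧ (∀ ω, 0 ≤ h ω) ∧ (∀ ω, h ω ≤ 1) ∧
      r = ∫ ω, h ω ∂(lam.withDensity fun ω => ENNReal.ofReal (p ω)) -
        ∫ ω, h ω ∂(lam.withDensity fun ω => ENNReal.ofReal (q ω))}, r ≤ β * b := by
    rintro r ⟨h, hm, h0, h1, rfl⟩
    refine (integral_sub_integral_le_measure hp hq hp0 hq0 hS hle hm h0 h1).trans ?_
    rw [hνS]
    exact div_le_self (by positivity) hZ1
  have upper : dHW1 (lam.withDensity fun ω => ENNReal.ofReal (p ω))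
      (lam.withDensity fun ω => ENNReal.ofReal (q ω)) ≤ β * b :=
    Real.sSup_le hub (by positivity)
  refine ⟨upper, fun hk => ⟨?_, upper⟩⟩
  have hbk : b / κ = β * b := by
    rw [hk]; field_simp
  have hZ_one : Z = 1 := by linarith
  have hc : 0 < β * b := by positivity
  set T : Set Ω := S ∩ {ω | p ω < q ω}
  have hT : MeasurableSet T := hS.inter (measurableSet_lt hp hq)
  set h : Ω → ℝ := Tᶜ.indicator fun _ => 1
  have hm : Measurable h := measurable_const.indicator hT.compl
  have h0 : ∀ ω, 0 ≤ h ω := Set.indicator_nonneg fun _ _ => zero_le_one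
  have h1 : ∀ ω, h ω ≤ 1 := Set.indicator_le_self' fun _ _ => zero_le_one
  refine le_csSup ⟨β * b, hub⟩ ⟨h, hm, h0, h1, ?_⟩
  rw [(integral_sub_integral_eq_integral_one_sub hp hq hp0 hq0 hm h0 h1).2, hSval, hμS, hνS,
    hbk, hZ_one, div_one, mul_assoc, ← integral_mul_const, ← integral_indicator hS]
  congr 1
  funext ω
  by_cases hs : ω ∈ S
  · rw [Set.indicator_of_mem hs, max_mul_of_nonneg _ _ hc.le, sub_mul, div_mul_cancel₀ _ hc.ne',
      div_mul_cancel₀ _ hc.ne', zero_mul]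
    by_cases hpq : p ω < q ω
    · simp [h, T, hs, hpq, hpq.le]
    · simp [h, T, hpq, not_lt.1 hpq]
  · simp [h, T, hs]
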